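/- For every integer n ≥ 0, the number of lattice paths of length 2n that stay in the strip [-2, 1] and end at height 0 is equal to the number of lattice paths of length 2n+2 that stay in the strip [0, 3] and end at height 0. -/

import Mathlib

/-- The height of a lattice path `s : Fin n → ℤ` after `j` steps:
the sum of the first `j` steps. -/
def pathHeight {n : ℕ} (s : Fin n → ℤ) (j : ℕ) : ℤ :=
  ∑ i ∈ Finset.univ.filter (fun i : Fin n => (i : ℕ) < j), s i

/-- The number of lattice paths of length `n` (steps `±1`) whose height stays in
`[a, b]` at every time `0 ≤ j ≤ n` and whose final height lies in `E`. -/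
noncomputable def pathCount (n : ℕ) (a b : ℤ) (E : Set ℤ) : ℕ :=
  Nat.card {s : Fin n → ℤ //
    (∀ i, s i ∈ ({1, -1} : Set ℤ)) ∧
    (∀ j ≤ n, pathHeight s j ∈ Set.Icc a b) ∧
    pathHeight s n ∈ E}

theorem pathHeight_zero {n : ℕ} (s : Fin n → ℤ) : pathHeight s 0 = 0 := by
  simp [pathHeight]

theorem pathHeight_neg {n : ℕ} (s : Fin n → ℤ) (j : ℕ) :
    pathHeight (-s) j = -pathHeight s j := by
  simp [pathHeight]

theorem pathHeight_cons_succ {n : ℕ} (x : ℤ) (s : Fin n → ℤ) (j : ℕ) :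
    pathHeight (Fin.cons x s : Fin (n + 1) → ℤ) (j + 1) = x + pathHeight s j := by
  simp [pathHeight, Finset.sum_filter, Fin.sum_univ_succ]

theorem pathHeight_snoc_of_le {n : ℕ} (s : Fin n → ℤ) (x : ℤ) {j : ℕ} (hj : j ≤ n) :
    pathHeight (Fin.snoc s x : Fin (n + 1) → ℤ) j = pathHeight s j := by
  simp [pathHeight, Finset.sum_filter, Fin.sum_univ_castSucc, hj.not_gt]

theorem pathHeight_snoc_self {n : ℕ} (s : Fin n → ℤ) (x : ℤ) :
    pathHeight (Fin.snoc s x : Fin (n + 1) → ℤ) (n + 1) = pathHeight s n + x := by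
  simp [pathHeight, Finset.sum_filter, Fin.sum_univ_castSucc]

/-- A path is admissible for the strip `[-2, 1]` iff its reflection, preceded by an up step and
followed by a down step, is admissible for the strip `[0, 3]`. -/
theorem isStripPath_cons_snoc_neg_iff {m : ℕ} (s : Fin m → ℤ) (t : Fin (m + 2) → ℤ)
    (ht : t = Fin.cons 1 (Fin.snoc (-s) (-1) : Fin (m + 1) → ℤ)) :
    ((∀ i, t i ∈ ({1, -1} : Set ℤ)) ∧ (∀ j ≤ m + 2, pathHeight t j ∈ Set.Icc (0 : ℤ) 3) ∧
      pathHeight t (m + 2) ∈ ({0} : Set ℤ)) ↔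
    ((∀ i, s i ∈ ({1, -1} : Set ℤ)) ∧ (∀ j ≤ m, pathHeight s j ∈ Set.Icc (-2 : ℤ) 1) ∧
      pathHeight s m ∈ ({0} : Set ℤ)) := by
  have hmid : ∀ j ≤ m, pathHeight t (j + 1) = 1 - pathHeight s j := fun j hj => by
    rw [ht, pathHeight_cons_succ, pathHeight_snoc_of_le _ _ hj, pathHeight_neg, sub_eq_add_neg]
  have hend : pathHeight t (m + 2) = -pathHeight s m := by
    rw [ht, pathHeight_cons_succ, pathHeight_snoc_self, pathHeight_neg]
    ring
  have hsteps : (∀ i, t i ∈ ({1, -1} : Set ℤ)) ↔ ∀ i, s i ∈ ({1, -1} : Set ℤ) := by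
    rw [Fin.forall_fin_succ, Fin.forall_fin_succ']
    simp only [ht, Fin.cons_zero, Fin.cons_succ,
      Fin.snoc_castSucc, Fin.snoc_last, Pi.neg_apply, Set.mem_insert_iff, Set.mem_singleton_iff]
    grind
  rw [hsteps, hend]
  refine and_congr_right fun _ => ?_
  simp only [Set.mem_singleton_iff, neg_eq_zero, Set.mem_Icc]
  refine and_congr_left fun h0 => ⟨fun h j hj => ?_, fun h j hj => ?_⟩
  · have := h (j + 1) (by omega)
    rw [hmid j hj] at this
    omega
  · rcases j with _ | j
    · simp [pathHeight_zero]
    · rcases Nat.lt_or_ge m j with hlt | hle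
      · obtain rfl : j = m + 1 := by omega
        rw [hend, h0]
        norm_num
      · have := h j hle
        rw [hmid j hle]
        omega

/-- A path in the strip `[0, 3]` from `0` to `0` with at least two steps begins with an up step
and ends with a down step. -/
theorem exists_eq_cons_snoc_neg {m : ℕ} (t : Fin (m + 2) → ℤ)
    (hsteps : ∀ i, t i ∈ ({1, -1} : Set ℤ))
    (hstrip : ∀ j ≤ m + 2, pathHeight t j ∈ Set.Icc (0 : ℤ) 3)
    (hend : pathHeight t (m + 2) ∈ ({0} : Set ℤ)) :
    ∃ s : Fin m → ℤ, t = Fin.cons 1 (Fin.snoc (-s) (-1) : Fin (m + 1) → ℤ) := by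
  obtain ⟨x, u, y, rfl⟩ : ∃ (x : ℤ) (u : Fin m → ℤ) (y : ℤ),
      t = Fin.cons x (Fin.snoc u y : Fin (m + 1) → ℤ) :=
    ⟨t 0, Fin.init (Fin.tail t), Fin.tail t (Fin.last m), by
      rw [Fin.snoc_init_self, Fin.cons_self_tail]⟩
  have hx := hsteps 0
  have hy := hsteps (Fin.last m).succ
  have h1 := hstrip (0 + 1) (by omega)
  have hm := hstrip (m + 1) (by omega)
  simp only [Fin.cons_zero, Fin.cons_succ, Fin.snoc_last, Set.mem_insert_iff,
    Set.mem_singleton_iff, pathHeight_cons_succ, pathHeight_zero, pathHeight_snoc_self,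
    pathHeight_snoc_of_le u y le_rfl, Set.mem_Icc] at hx hy h1 hm hend
  obtain rfl : x = 1 := by omega
  obtain rfl : y = -1 := by omega
  exact ⟨-u, by rw [neg_neg]⟩

theorem stmt_18 (n : ℕ) :
    pathCount (2 * n) (-2) 1 ({0} : Set ℤ) = pathCount (2 * n + 2) 0 3 ({0} : Set ℤ) := by
  refine Nat.card_congr (Equiv.ofBijective
    (fun s => ⟨_, (isStripPath_cons_snoc_neg_iff s.1 _ rfl).2 s.2⟩) ⟨fun s s' h => ?_, ?_⟩)
  · have h' := Fin.cons_right_injective (α := fun _ => ℤ) _ (Subtype.ext_iff.1 h)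
    exact Subtype.ext (neg_injective (Fin.snoc_left_injective (α := fun _ => ℤ) _ h'))
  · rintro ⟨t, ht⟩
    obtain ⟨s, hs⟩ := exists_eq_cons_snoc_neg t ht.1 ht.2.1 ht.2.2
    exact ⟨⟨s, (isStripPath_cons_snoc_neg_iff s t hs).1 ht⟩, Subtype.ext hs.symm⟩
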